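/- Let n ≥ 1, a ≥ 1, let 0 = k_{-1} ≤ k_0 ≤ k_1 ≤ ⋯ ≤ k_a = n be integers, and let h_1,…,h_n ∈ ℤⁿ be the rows of an integer matrix H̃. For every x ∈ ℤⁿ the following are equivalent: (i) for all i ∈ {0,1,…,a−1} and all j with k_i + 1 ≤ j ≤ n, 2^{i+1} divides h_j·x; (ii) for all i ∈ {0,1,…,a} and all j with k_{i−1} < j ≤ k_i, 2^i divides h_j·x (equivalently, D·H̃·x ∈ ℤⁿ where D is the diagonal rational matrix with d_{j,j} = 2^{−i} for k_{i−1} < j ≤ k_i). Thus the congruence definition and the check-matrix definition of the Construction D' lattice define the same set of integer vectors. -/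

import Mathlib

/-- A sequence that is at most `c` at index `m` and exceeds `c` at a later index `N` crosses `c`
between two consecutive indices of `[m, N]`. -/
theorem Nat.exists_le_and_lt_succ_of_le_of_lt {α : Type*} [LinearOrder α] (f : ℕ → α) {c : α}
    {m N : ℕ} (hmN : m ≤ N) (hm : f m ≤ c) (hN : c < f N) :
    ∃ i, m ≤ i ∧ i < N ∧ f i ≤ c ∧ c < f (i + 1) := by
  induction N, hmN using Nat.le_induction with
  | base => exact absurd hN hm.not_gt
  | succ N hmN ih =>
    rcases le_or_gt (f N) c with h | h
    · exact ⟨N, hmN, N.lt_succ_self, h, hN⟩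
    · obtain ⟨i, hmi, hiN, hi⟩ := ih h
      exact ⟨i, hmi, hiN.trans N.lt_succ_self, hi⟩


/-- Equivalence of the congruence definition and the check-matrix definition of
Construction D'.  Here `k (i+1)` plays the role of the paper's `k_i` (so `k 0 = k_{-1} = 0`,
`k (a+1) = k_a = n`), and row/coordinate indices are 0-based, so the paper's 1-based condition
`k_i + 1 ≤ j ≤ n` becomes `k (i+1) ≤ j` and `k_{i-1} < j ≤ k_i` becomes `k i ≤ j < k (i+1)`. -/
theorem construction_Dprime_congruence_iff_checkMatrix
    (n a : ℕ) (hn : 1 ≤ n) (ha : 1 ≤ a)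
    (k : ℕ → ℕ) (hk0 : k 0 = 0) (hmono : ∀ i ≤ a, k i ≤ k (i + 1)) (hka : k (a + 1) = n)
    (Ht : Matrix (Fin n) (Fin n) ℤ) (x : Fin n → ℤ) :
    (∀ i < a, ∀ j : Fin n, k (i + 1) ≤ (j : ℕ) →
        ((2 : ℤ) ^ (i + 1)) ∣ ∑ l, Ht j l * x l) ↔
    (∀ i ≤ a, ∀ j : Fin n, k i ≤ (j : ℕ) → (j : ℕ) < k (i + 1) →
        ((2 : ℤ) ^ i) ∣ ∑ l, Ht j l * x l) := by
  constructor
  · rintro h (_ | i) hi j hj -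
    · simp
    · exact h i hi j hj
  · intro h i hi j hj
    obtain ⟨m, him, hma, hm, hm'⟩ := Nat.exists_le_and_lt_succ_of_le_of_lt k
      (show i + 1 ≤ a + 1 by lia) hj (hka.symm ▸ j.isLt)
    exact (pow_dvd_pow 2 him).trans (h m (Nat.lt_succ_iff.mp hma) j hm hm')
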